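/- arXiv:1911.07215 — 2 statements merged into one kernel-verified Lean document; each statement's English description precedes it below -/
import Mathlib

section
/- Let c(n) denote the coefficients of the q-expansion of the modular j-invariant, j(τ) = 1/q + Σ_{n≥0} c(n) qⁿ with q = e^{2πiτ}. Then all c(n) are nonnegative, and for every n ≥ 1 we have c(n) < e^{4π√n}. -/
open Complex Real

noncomputable def jP (q : ℂ) : ℂ := ∏' n : ℕ, (1 - q ^ (n + 1)) ^ 24
noncomputable def jE (q : ℂ) : ℂ :=
  1 + 240 * ∑' n : ℕ, (∑ d ∈ (n + 1).divisors, (d : ℂ) ^ 3) * q ^ (n + 1)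

lemma jE_eq (z : UpperHalfPlane) : jE (Complex.exp (2 * π * I * z)) = ModularForm.E₄ z := by
  have h := EisensteinSeries.q_expansion_bernoulli (k := 4) (by norm_num) (by decide) z
  rw [h, tsum_pnat_eq_tsum_succ
    (f := fun n : ℕ => (ArithmeticFunction.sigma (4 - 1) n : ℂ) * cexp (2 * π * I * z) ^ (n : ℤ))]
  have : bernoulli 4 = -1/30 := by
    rw [bernoulli_eq_bernoulli'_of_ne_one (by norm_num), bernoulli'_four]
  rw [this, jE]
  simp only [ArithmeticFunction.sigma_apply]
  push_cast
  norm_num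
  refine tsum_congr fun n => ?_
  norm_cast

lemma jP_eq (z : UpperHalfPlane) : Complex.exp (2 * π * I * z) * jP (Complex.exp (2 * π * I * z)) =
    ModularForm.discriminant z := by
  rw [ModularForm.discriminant_eq_q_prod, jP]
  simp [ModularForm.eta_q, Function.Periodic.qParam]

lemma j_S (z w : UpperHalfPlane) (hw : (w : ℂ) = (-(z : ℂ))⁻¹) :
    ModularForm.E₄ w ^ 3 * ModularForm.discriminant z =
      ModularForm.E₄ z ^ 3 * ModularForm.discriminant w := by
  have hw' : w = .mk _ z.im_inv_neg_coe_pos := UpperHalfPlane.ext hw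
  have h1 := congrFun ModularForm.discriminant_S_invariant z
  rw [SlashInvariantForm.slash_S_apply, ← hw'] at h1
  have h2 := congrFun (SlashInvariantForm.slash_action_eqn ModularForm.E₄
    (ModularGroup.S : Matrix.GeneralLinearGroup (Fin 2) ℝ) ⟨ModularGroup.S, rfl⟩) z
  rw [← ModularForm.SL_slash, SlashInvariantForm.slash_S_apply, ← hw'] at h2
  rw [← h1, ← h2]
  have := z.ne_zero
  simp only [zpow_neg, mul_pow]
  norm_cast
  field_simp

open Metric

/-- analytic on the disc with nonnegative Taylor coefficients -/
def NN (f : ℂ → ℂ) : Prop :=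
  DifferentiableOn ℂ f (ball 0 1) ∧ ∀ n, ∃ r : ℝ, 0 ≤ r ∧ iteratedDeriv n f 0 = r

lemma tsum_taylor (a : ℕ → ℂ) (ha : ∀ r : ℝ, 0 < r → r < 1 → Summable fun n => ‖a n‖ * r ^ n) :
    DifferentiableOn ℂ (fun q => ∑' n, a n * q ^ n) (ball 0 1) ∧
    ∀ n, iteratedDeriv n (fun q => ∑' n, a n * q ^ n) 0 = n.factorial * a n := by
  set p := FormalMultilinearSeries.ofScalars ℂ a with hp
  have hrad : 1 ≤ p.radius := by
    refine ENNReal.le_of_forall_nnreal_lt fun r hr => ?_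
    have hr : r < 1 := by exact_mod_cast hr
    rcases eq_or_ne r 0 with rfl | h0
    · simp
    apply p.le_radius_of_summable_norm
    simp only [hp, FormalMultilinearSeries.ofScalars_norm]
    exact ha r (by positivity) (by exact_mod_cast hr)
  have hb : HasFPowerSeriesOnBall (fun q => ∑' n, a n * q ^ n) p 0 1 := by
    have := (p.hasFPowerSeriesOnBall (lt_of_lt_of_le one_pos hrad)).mono one_pos hrad
    convert! this using 1
    ext q
    have := FormalMultilinearSeries.ofScalars_sum_eq (E := ℂ) a q
    simpa [FormalMultilinearSeries.ofScalarsSum] using this.symm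
  refine ⟨?_, fun n => ?_⟩
  · have := hb.differentiableOn
    rwa [← ENNReal.ofReal_one, Metric.eball_ofReal] at this
  · have h := hb.factorial_smul 1 n
    rw [iteratedDeriv_eq_iteratedFDeriv, ← h]
    simp [hp, FormalMultilinearSeries.ofScalars]

lemma NN.contDiffAt {f : ℂ → ℂ} (hf : NN f) (n : ℕ) : ContDiffAt ℂ n f 0 :=
  (hf.1.analyticAt (ball_mem_nhds 0 one_pos)).contDiffAt

lemma NN.mul {f g : ℂ → ℂ} (hf : NN f) (hg : NN g) : NN (f * g) := by
  refine ⟨hf.1.mul hg.1, fun n => ?_⟩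
  choose a ha using hf.2
  choose b hb using hg.2
  refine ⟨∑ i ∈ .range (n + 1), n.choose i * a i * b (n - i), ?_, ?_⟩
  · exact Finset.sum_nonneg fun i _ => mul_nonneg (mul_nonneg (by positivity) (ha i).1) (hb _).1
  · rw [iteratedDeriv_mul (hf.contDiffAt n) (hg.contDiffAt n)]
    push_cast
    simp only [ha, hb]

lemma NN.one : NN 1 := by
  refine ⟨by fun_prop, fun n => ?_⟩
  refine ⟨if n = 0 then 1 else 0, by split_ifs <;> norm_num, ?_⟩
  have := iteratedDeriv_const (𝕜 := ℂ) (n := n) (c := (1:ℂ)) (x := 0)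
  rw [show (1 : ℂ → ℂ) = fun _ => 1 from rfl, this]
  split_ifs <;> simp

lemma NN.pow {f : ℂ → ℂ} (hf : NN f) (k : ℕ) : NN (f ^ k) := by
  induction k with
  | zero => simpa using NN.one
  | succ k ih => rw [pow_succ]; exact ih.mul hf

lemma NN.prod {ι : Type*} {f : ι → ℂ → ℂ} (s : Finset ι) (hf : ∀ i, NN (f i)) :
    NN (∏ i ∈ s, f i) := by
  classical
  induction s using Finset.induction_on with
  | empty => simpa using NN.one
  | insert a s h ih => rw [Finset.prod_insert h]; exact (hf a).mul ih

lemma NN.congr {f g : ℂ → ℂ} (hf : NN f) (h : ∀ q ∈ ball (0:ℂ) 1, g q = f q) : NN g := by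
  refine ⟨hf.1.congr h, fun n => ?_⟩
  have : g =ᶠ[nhds 0] f := Filter.eventually_of_mem (ball_mem_nhds 0 one_pos) h
  rw [this.iteratedDeriv_eq]
  exact hf.2 n

lemma NN.tsum (a : ℕ → ℝ) (h0 : ∀ n, 0 ≤ a n)
    (ha : ∀ r : ℝ, 0 < r → r < 1 → Summable fun n => a n * r ^ n) :
    NN (fun q => ∑' n, (a n : ℂ) * q ^ n) := by
  have := tsum_taylor (fun n => (a n : ℂ)) (by simpa [abs_of_nonneg, h0] using ha)
  refine ⟨this.1, fun n => ⟨n.factorial * a n, mul_nonneg (by positivity) (h0 n), ?_⟩⟩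
  rw [this.2]; simp

lemma NN.geom (m : ℕ) : NN (fun q => (1 - q ^ (m + 1))⁻¹) := by
  refine (NN.tsum (fun n => if m + 1 ∣ n then 1 else 0) (fun n => by split_ifs <;> norm_num)
    (fun r h0 h1 => ?_)).congr fun q hq => ?_
  · refine Summable.of_nonneg_of_le (fun n => ?_) (fun n => ?_)
      (summable_geometric_of_lt_one h0.le h1)
    · split_ifs <;> simp; positivity
    · split_ifs <;> simp; positivity
  · have hq : ‖q‖ < 1 := by simpa using hq
    rw [← tsum_geometric_of_norm_lt_one (by
      rw [norm_pow]; exact pow_lt_one₀ (norm_nonneg _) hq (by omega))]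
    have hinj : Function.Injective fun k : ℕ => (m + 1) * k := fun a b h => by simpa using h
    rw [← hinj.tsum_eq (f := fun n : ℕ => ((if m + 1 ∣ n then (1:ℝ) else 0 : ℝ) : ℂ) * q ^ n)]
    · simp [pow_mul]
    · intro n hn
      simp only [Function.mem_support] at hn
      by_cases h : m + 1 ∣ n
      · obtain ⟨k, rfl⟩ := h; exact ⟨k, rfl⟩
      · simp [h] at hn

lemma NN.lim {ι : Type*} {l : Filter ι} [l.NeBot] {F : ι → ℂ → ℂ} {f : ℂ → ℂ}
    (hF : ∀ i, NN (F i)) (h : TendstoLocallyUniformlyOn F f l (ball 0 1)) : NN f := by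
  have hd := h.differentiableOn (.of_forall fun i => (hF i).1) isOpen_ball
  refine ⟨hd, fun n => ?_⟩
  have key : ∀ n, TendstoLocallyUniformlyOn (fun i => iteratedDeriv n (F i)) (iteratedDeriv n f)
      l (ball 0 1) ∧ ∀ i, DifferentiableOn ℂ (iteratedDeriv n (F i)) (ball 0 1) := by
    intro n
    induction n with
    | zero => simpa using ⟨h, fun i => (hF i).1⟩
    | succ n ih =>
      simp only [iteratedDeriv_succ]
      exact ⟨ih.1.deriv (.of_forall ih.2) isOpen_ball, fun i => (ih.2 i).deriv isOpen_ball⟩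
  have ht := (key n).1.tendsto_at (mem_ball_self one_pos)
  choose a ha using fun i => (hF i).2 n
  simp only [ha] at ht
  have hr := (Complex.continuous_re.tendsto _).comp ht
  have hi := (Complex.continuous_im.tendsto _).comp ht
  simp only [Function.comp_def, ofReal_re, ofReal_im] at hr hi
  refine ⟨(iteratedDeriv n f 0).re, ge_of_tendsto' hr fun i => (ha i).1, ?_⟩
  apply Complex.ext
  · simp
  · simpa using (tendsto_nhds_unique hi tendsto_const_nhds)

lemma tprod_ne_zero' {q : ℂ} (hq : ‖q‖ < 1) : ∏' n : ℕ, (1 - q ^ (n + 1)) ≠ 0 := by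
  refine tprod_one_add_ne_zero_of_summable (f := fun n : ℕ ↦ -q ^ (n + 1)) ?_ ?_
  · intro i h
    have : q ^ (i + 1) = 1 := by linear_combination -h
    have h2 := congrArg norm this
    rw [norm_pow, norm_one] at h2
    exact absurd h2 (pow_lt_one₀ (norm_nonneg _) hq (by omega)).ne
  · simpa using (summable_nat_add_iff 1).mpr (summable_geometric_of_lt_one (norm_nonneg _) hq)

lemma jP_eq_pow {q : ℂ} (hq : ‖q‖ < 1) : jP q = (∏' n : ℕ, (1 - q ^ (n + 1))) ^ 24 :=
  (ModularForm.multipliable_one_sub_pow hq).tprod_pow 24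

lemma jP_ne_zero {q : ℂ} (hq : ‖q‖ < 1) : jP q ≠ 0 := by
  rw [jP_eq_pow hq]; exact pow_ne_zero _ (tprod_ne_zero' hq)

lemma NN_jP_inv : NN (fun q => (jP q)⁻¹) := by
  have h1 := ModularForm.multipliableLocallyUniformlyOn_one_sub_pow.hasProdLocallyUniformlyOn
  have h2 := TendstoLocallyUniformlyOn.inv₀ h1
    ModularForm.differentiableOn_tprod_one_sub_pow.continuousOn
    (fun q hq => tprod_ne_zero' (by simpa using hq))
  have h3 : NN (fun q => ∏' n : ℕ, (1 - q ^ (n + 1)))⁻¹ := by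
    refine NN.lim (fun s => ?_) h2
    refine (NN.prod s NN.geom).congr fun q _ => ?_
    simp
  refine (h3.pow 24).congr fun q hq => ?_
  rw [jP_eq_pow (by simpa using hq)]
  simp

lemma sig_le (n : ℕ) : (∑ d ∈ n.divisors, (d : ℝ) ^ 3) ≤ (n : ℝ) ^ 4 := by
  have := ArithmeticFunction.sigma_le_pow_succ 3 n
  rw [ArithmeticFunction.sigma_apply] at this
  exact_mod_cast this

lemma jE_summable {r : ℝ} (h0 : 0 < r) (h1 : r < 1) :
    Summable fun n : ℕ => (∑ d ∈ n.divisors, (d : ℝ) ^ 3) * r ^ n := by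
  have := summable_pow_mul_geometric_of_norm_lt_one (R := ℝ) 4 (r := r)
    (by rwa [Real.norm_of_nonneg h0.le])
  refine Summable.of_nonneg_of_le (fun n => by positivity) (fun n => ?_) this
  gcongr; exact sig_le n

lemma NN_jE : NN jE := by
  have hs : ∀ r : ℝ, 0 < r → r < 1 → Summable fun n : ℕ =>
      (if n = 0 then 1 else 240 * ∑ d ∈ n.divisors, (d : ℝ) ^ 3) * r ^ n := by
    intro r h0 h1
    rw [← summable_nat_add_iff 1]
    have := ((summable_nat_add_iff 1).2 (jE_summable h0 h1)).mul_left 240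
    refine this.congr fun n => ?_
    simp; ring
  refine (NN.tsum _ (fun n => by split_ifs <;> positivity) hs).congr fun q hq => ?_
  rw [Summable.tsum_eq_zero_add]
  · simp [jE, ← tsum_mul_left, mul_assoc]
  · rcases eq_or_ne q 0 with rfl | h
    · exact summable_of_ne_finset_zero (s := {0}) fun n hn => by
        have : n ≠ 0 := by simpa using hn
        simp [this]
    apply Summable.of_norm
    refine (hs ‖q‖ (by positivity) (by simpa using hq)).congr fun n => ?_
    rw [norm_mul, norm_pow, Complex.norm_real, Real.norm_of_nonneg]
    split_ifs <;> positivity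

lemma surj_q {q : ℂ} (h0 : q ≠ 0) (hq : ‖q‖ < 1) :
    ∃ τ : ℂ, 0 < τ.im ∧ Complex.exp (2 * π * I * τ) = q := by
  refine ⟨Function.Periodic.invQParam 1 q,
    Function.Periodic.im_invQParam_pos_of_norm_lt_one one_pos hq h0, ?_⟩
  have := Function.Periodic.qParam_right_inv (h := 1) one_ne_zero h0
  simpa [Function.Periodic.qParam] using this

lemma norm_jP_le {q : ℝ} (h0 : 0 < q) (h1 : q < 1) : ‖jP q‖ ≤ 1 := by
  have hq : ‖(q : ℂ)‖ < 1 := by rwa [Complex.norm_real, Real.norm_of_nonneg h0.le]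
  rw [jP_eq_pow hq, norm_pow]
  apply pow_le_one₀ (norm_nonneg _)
  have := (ModularForm.multipliable_one_sub_pow hq).hasProd.norm
  refine le_of_tendsto' this fun s => Finset.prod_le_one (fun _ _ => norm_nonneg _) fun i _ => ?_
  have h2 : q ^ (i + 1) ≤ 1 := pow_le_one₀ h0.le h1.le
  have h3 : 0 < q ^ (i + 1) := by positivity
  rw [show (1 - (q : ℂ) ^ (i + 1)) = ((1 - q ^ (i + 1) : ℝ) : ℂ) by push_cast; rfl,
    Complex.norm_real, Real.norm_of_nonneg (by linarith)]
  linarith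

lemma one_lt_norm_jE {q : ℝ} (h0 : 0 < q) (h1 : q < 1) : 1 < ‖jE q‖ := by
  have hs := (summable_nat_add_iff 1).2 (jE_summable h0 h1)
  have h2 : jE q = ((1 + 240 * ∑' n : ℕ, (∑ d ∈ (n + 1).divisors, (d : ℝ) ^ 3) * q ^ (n + 1) : ℝ) : ℂ) := by
    rw [jE]; push_cast; rfl
  have h3 : 0 < ∑' n : ℕ, (∑ d ∈ (n + 1).divisors, (d : ℝ) ^ 3) * q ^ (n + 1) :=
    hs.tsum_pos (fun n => by positivity) 0 (by simpa using h0)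
  rw [h2, Complex.norm_real, Real.norm_of_nonneg (by positivity)]
  linarith

section main
variable {c : ℕ → ℤ}
  (hc : ∀ q : ℂ, q ≠ 0 → ‖q‖ < 1 →
    (1 / q + ∑' n : ℕ, (c n : ℂ) * q ^ n) * (q * jP q) = jE q ^ 3)

include hc

lemma c_summable {r : ℝ} (h0 : 0 < r) (h1 : r < 1) : Summable fun n => |(c n : ℝ)| * r ^ n := by
  have hq : ‖(r : ℂ)‖ < 1 := by rwa [Complex.norm_real, Real.norm_of_nonneg h0.le]
  have h0' : (r : ℂ) ≠ 0 := by exact_mod_cast h0.ne'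
  have hS : Summable fun n : ℕ => (c n : ℂ) * (r : ℂ) ^ n := by
    by_contra h
    have := hc r h0' hq
    rw [tsum_eq_zero_of_not_summable h, add_zero, ← mul_assoc, one_div_mul_cancel h0', one_mul] at this
    have h2 := norm_jP_le h0 h1
    rw [this, norm_pow] at h2
    exact absurd h2 (not_le.2 (one_lt_pow₀ (one_lt_norm_jE h0 h1) (by norm_num)))
  refine hS.norm.congr fun n => ?_
  rw [norm_mul, norm_pow, Complex.norm_real, Real.norm_of_nonneg h0.le, Complex.norm_intCast]

lemma c_nonneg (n : ℕ) : 0 ≤ c n := by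
  set a : ℕ → ℂ := fun n => if n = 0 then 1 else c (n - 1) with ha
  have hs : ∀ r : ℝ, 0 < r → r < 1 → Summable fun n => ‖a n‖ * r ^ n := by
    intro r h0 h1
    rw [← summable_nat_add_iff 1]
    refine ((c_summable hc h0 h1).mul_right r).congr fun n => ?_
    simp [ha, pow_succ, mul_assoc]
  obtain ⟨-, hd⟩ := tsum_taylor a hs
  have hN : NN (fun q => ∑' n, a n * q ^ n) := by
    refine ((NN_jE.pow 3).mul NN_jP_inv).congr fun q hq => ?_
    have hq : ‖q‖ < 1 := by simpa using hq
    simp only [Pi.mul_apply, Pi.pow_apply]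
    rw [eq_mul_inv_iff_mul_eq₀ (jP_ne_zero hq)]
    rcases eq_or_ne q 0 with rfl | h0
    · have : ∑' n, a n * (0 : ℂ) ^ n = 1 := by
        rw [tsum_eq_single 0]
        · simp [ha]
        · intro n hn; simp [hn]
      rw [this]; simp [jP, jE]
    · rw [← hc q h0 hq, Summable.tsum_eq_zero_add]
      · simp only [ha]
        simp only [Nat.add_eq_zero_iff, one_ne_zero, and_false, if_false, if_true, pow_zero,
          Nat.add_sub_cancel, pow_succ, ← mul_assoc, tsum_mul_right]
        field_simp
      · apply Summable.of_norm
        refine (hs ‖q‖ (by positivity) hq).congr fun n => ?_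
        rw [norm_mul, norm_pow]
  obtain ⟨r, hr, h⟩ := hN.2 (n + 1)
  rw [hd] at h
  simp only [ha, Nat.add_eq_zero_iff, one_ne_zero, and_false, if_false, Nat.add_sub_cancel] at h
  have h' : (((n + 1).factorial : ℝ) * c n) = r := by exact_mod_cast h
  have h3 : (0 : ℝ) < (n + 1).factorial := by positivity
  have : (0 : ℝ) ≤ c n := by
    by_contra hneg
    nlinarith [mul_pos h3 (neg_pos.2 (not_le.1 hneg))]
  exact_mod_cast this

lemma j_inv {t : ℝ} (ht : 0 < t) :
    1 / Real.exp (-(2 * π * t)) + ∑' n, (c n : ℝ) * Real.exp (-(2 * π * t)) ^ n =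
    1 / Real.exp (-(2 * π * t⁻¹)) + ∑' n, (c n : ℝ) * Real.exp (-(2 * π * t⁻¹)) ^ n := by
  have hi : ∀ s : ℝ, 0 < s → 0 < (I * s : ℂ).im := by intro s hs; simpa using hs
  have hq : ∀ s : ℝ, Complex.exp (2 * π * I * (I * s)) = (Real.exp (-(2 * π * s)) : ℝ) := by
    intro s
    push_cast
    congr 1
    linear_combination 2 * π * s * I_mul_I
  have key : ∀ s : ℝ, ∀ hs : 0 < s,
      ((1 / Real.exp (-(2 * π * s)) + ∑' n, (c n : ℝ) * Real.exp (-(2 * π * s)) ^ n : ℝ) : ℂ) *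
      ModularForm.discriminant ⟨I * s, hi s hs⟩ = ModularForm.E₄ ⟨I * s, hi s hs⟩ ^ 3 := by
    intro s hs
    rw [← jP_eq, ← jE_eq]
    simp only [hq]
    rw [← hc]
    · push_cast; rfl
    · exact_mod_cast (Real.exp_pos _).ne'
    · rw [Complex.norm_real, Real.norm_of_nonneg (Real.exp_pos _).le, Real.exp_lt_one_iff]
      have := Real.pi_pos
      have : 0 < 2 * π * s := by positivity
      linarith
  have h1 := key t ht
  have h2 := key t⁻¹ (by positivity)
  have h3 := j_S ⟨I * t, hi t ht⟩ ⟨I * (t⁻¹ : ℝ), hi t⁻¹ (by positivity)⟩ (by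
    simp [mul_comm])
  rw [← h1, ← h2] at h3
  have n1 := ModularForm.discriminant_ne_zero ⟨I * t, hi t ht⟩
  have n2 := ModularForm.discriminant_ne_zero ⟨I * (t⁻¹ : ℝ), hi t⁻¹ (by positivity)⟩
  rw [mul_right_comm, mul_left_inj' n2, mul_left_inj' n1] at h3
  have h4 := h3.symm
  exact_mod_cast h4
end main

section bound
variable {c : ℕ → ℝ} (h0 : ∀ n, 0 ≤ c n)
  (hs : ∀ r : ℝ, 0 < r → r < 1 → Summable fun n => c n * r ^ n)
  (hJ : ∀ t : ℝ, 0 < t → 1 / Real.exp (-(2 * π * t)) + ∑' n, c n * Real.exp (-(2 * π * t)) ^ n =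
    1 / Real.exp (-(2 * π * t⁻¹)) + ∑' n, c n * Real.exp (-(2 * π * t⁻¹)) ^ n)
include h0 hs hJ

lemma hasSum_diff {t : ℝ} (ht : 0 < t) :
    HasSum (fun n => c n * (Real.exp (-(2 * π * t)) ^ n - Real.exp (-(2 * π * t⁻¹)) ^ n))
      (1 / Real.exp (-(2 * π * t⁻¹)) - 1 / Real.exp (-(2 * π * t))) := by
  have hlt : ∀ s : ℝ, 0 < s → Real.exp (-(2 * π * s)) < 1 := fun s hs => by
    have := Real.pi_pos
    have : 0 < 2 * π * s := by positivity
    rw [Real.exp_lt_one_iff]; linarith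
  have a1 := (hs _ (Real.exp_pos _) (hlt t ht)).hasSum
  have a2 := (hs _ (Real.exp_pos _) (hlt t⁻¹ (by positivity))).hasSum
  have := a1.sub a2
  convert! this using 1
  · ext n; ring
  · linarith [hJ t ht]

lemma exp_ab {t : ℝ} (ht : 0 < t) (h1 : t < 1) :
    Real.exp (-(2 * π * t⁻¹)) < Real.exp (-(2 * π * t)) := by
  rw [Real.exp_lt_exp]
  have : t < t⁻¹ := h1.trans ((one_lt_inv₀ ht).2 h1)
  have := Real.pi_pos
  nlinarith

lemma part_le {t : ℝ} (ht : 0 < t) (h1 : t < 1) (s : Finset ℕ) :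
    ∑ n ∈ s, c n * (Real.exp (-(2 * π * t)) ^ n - Real.exp (-(2 * π * t⁻¹)) ^ n) ≤
      1 / Real.exp (-(2 * π * t⁻¹)) - 1 / Real.exp (-(2 * π * t)) := by
  refine sum_le_hasSum s (fun n _ => mul_nonneg (h0 n) (sub_nonneg.2 ?_)) (hasSum_diff h0 hs hJ ht)
  exact pow_le_pow_left₀ (Real.exp_pos _).le (exp_ab h0 hs hJ ht h1).le n

lemma bound_ge_two {n : ℕ} (hn : 2 ≤ n) : c n < Real.exp (4 * π * √n) := by
  have hn' : (2 : ℝ) ≤ n := by exact_mod_cast hn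
  have hs1 : 1 < √(n : ℝ) := Real.lt_sqrt_of_sq_lt (by linarith)
  have hsq : √(n : ℝ) ^ 2 = n := Real.sq_sqrt (by linarith)
  set s := √(n : ℝ)
  have ht : 0 < s⁻¹ := by positivity
  have h := part_le h0 hs hJ ht (inv_lt_one_of_one_lt₀ hs1) {n}
  have hab := exp_ab h0 hs hJ ht (inv_lt_one_of_one_lt₀ hs1)
  simp only [Finset.sum_singleton, inv_inv] at h hab
  set a := Real.exp (-(2 * π * s⁻¹)) with ha
  have hb : Real.exp (-(2 * π * s)) = a ^ n := by
    rw [ha, ← Real.exp_nat_mul, ← hsq]; congr 1; field_simp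
  have h4 : Real.exp (4 * π * s) = 1 / (a ^ n) ^ 2 := by
    rw [← hb, ← Real.exp_nat_mul, one_div, ← Real.exp_neg]; congr 1; push_cast; ring
  have ha0 : 0 < a := Real.exp_pos _
  have ha1 : a < 1 := by
    rw [ha, Real.exp_lt_one_iff]; have := Real.pi_pos
    have : 0 < 2 * π * s⁻¹ := by positivity
    linarith
  rw [h4]
  rw [hb] at h
  set b := a ^ n with hbd
  have hb0 : 0 < b := by positivity
  have hb1 : b < 1 := pow_lt_one₀ ha0.le ha1 (by omega)
  by_contra hcon
  rw [not_lt] at hcon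
  have hbn : b ^ n ≤ b := pow_le_of_le_one hb0.le hb1.le (by omega)
  have h5 : 1 / b ^ 2 * (b - b ^ n) ≤ 1 / b - 1 / a :=
    (mul_le_mul_of_nonneg_right hcon (by linarith)).trans h
  have h6 : 1 / a ≤ b ^ n / b ^ 2 := by
    have : 1 / b ^ 2 * (b - b ^ n) = 1 / b - b ^ n / b ^ 2 := by field_simp
    linarith
  rw [div_le_div_iff₀ ha0 (by positivity), hbd, ← pow_mul, ← pow_mul, ← pow_succ, one_mul,
    pow_le_pow_iff_right_of_lt_one₀ ha0 ha1] at h6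
  nlinarith

lemma exists_pos : ∃ m, 2 ≤ m ∧ 0 < c m := by
  by_contra hcon
  push Not at hcon
  have hz : ∀ m, 2 ≤ m → c m = 0 := fun m hm => le_antisymm (hcon m hm) (h0 m)
  have key : ∀ t : ℝ, 0 < t → t < 1 → c 1 = Real.exp (2 * π * (t + t⁻¹)) := by
    intro t ht h1
    have h := hasSum_diff h0 hs hJ ht
    have h' := h.unique (hasSum_sum_of_ne_finset_zero (s := Finset.range 2) fun n hn => by
      rw [hz n (by simpa [Nat.lt_iff_add_one_le] using hn), zero_mul])
    have hab := exp_ab h0 hs hJ ht h1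
    have he : Real.exp (2 * π * (t + t⁻¹)) =
        1 / (Real.exp (-(2 * π * t)) * Real.exp (-(2 * π * t⁻¹))) := by
      rw [← Real.exp_add, one_div, ← Real.exp_neg]; congr 1; ring
    rw [he]
    have ha := Real.exp_pos (-(2 * π * t))
    have hb := Real.exp_pos (-(2 * π * t⁻¹))
    set a := Real.exp (-(2 * π * t))
    set b := Real.exp (-(2 * π * t⁻¹))
    simp only [Finset.sum_range_succ, Finset.sum_range_zero, pow_zero, pow_one, sub_self, mul_zero, zero_add] at h'
    have h2 : (1 / b - 1 / a) = 1 / (a * b) * (a - b) := by field_simp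
    rw [h2] at h'
    exact (mul_right_cancel₀ (sub_pos.2 hab).ne' h').symm
  have e1 := key (1/2) (by norm_num) (by norm_num)
  have e2 := key (1/3) (by norm_num) (by norm_num)
  rw [e1, Real.exp_eq_exp] at e2
  have := Real.pi_pos
  norm_num at e2

lemma bound_one : c 1 < Real.exp (4 * π) := by
  obtain ⟨m, hm, hcm⟩ := exists_pos h0 hs hJ
  have key : ∀ t : ℝ, 0 < t → t < 1 →
      c 1 + c m * Real.exp (-(2 * π * t)) ^ (m - 1) ≤ Real.exp (2 * π * (t + t⁻¹)) := by
    intro t ht h1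
    have h := part_le h0 hs hJ ht h1 {1, m}
    rw [Finset.sum_pair (by omega)] at h
    have hab := exp_ab h0 hs hJ ht h1
    have he : Real.exp (2 * π * (t + t⁻¹)) =
        1 / (Real.exp (-(2 * π * t)) * Real.exp (-(2 * π * t⁻¹))) := by
      rw [← Real.exp_add, one_div, ← Real.exp_neg]; congr 1; ring
    rw [he]
    have ha := Real.exp_pos (-(2 * π * t))
    have hb := Real.exp_pos (-(2 * π * t⁻¹))
    set a := Real.exp (-(2 * π * t))
    set b := Real.exp (-(2 * π * t⁻¹))
    have h2 : (1 / b - 1 / a) = 1 / (a * b) * (a - b) := by field_simp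
    rw [h2] at h
    obtain ⟨k, rfl⟩ : ∃ k, m = k + 1 := ⟨m - 1, by omega⟩
    have h3 : a ^ k * (a - b) ≤ a ^ (k + 1) - b ^ (k + 1) := by
      have : b ^ k ≤ a ^ k := pow_le_pow_left₀ hb.le hab.le k
      rw [pow_succ, pow_succ]
      nlinarith
    have h4 := mul_le_mul_of_nonneg_left h3 hcm.le
    simp only [pow_one, Nat.add_sub_cancel] at h ⊢
    refine le_of_mul_le_mul_right ?_ (sub_pos.2 hab)
    nlinarith
  have hlim : c 1 + c m * Real.exp (-(2 * π * 1)) ^ (m - 1) ≤ Real.exp (2 * π * (1 + 1⁻¹)) := by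
    have hne : (nhdsWithin (1:ℝ) (Set.Iio 1)).NeBot := inferInstance
    have l1 : Filter.Tendsto (fun t : ℝ => c 1 + c m * Real.exp (-(2 * π * t)) ^ (m - 1))
        (nhdsWithin 1 (Set.Iio 1)) (nhds (c 1 + c m * Real.exp (-(2 * π * 1)) ^ (m - 1))) :=
      (Continuous.tendsto (by fun_prop) 1).mono_left nhdsWithin_le_nhds
    have l2 : Filter.Tendsto (fun t : ℝ => Real.exp (2 * π * (t + t⁻¹)))
        (nhdsWithin 1 (Set.Iio 1)) (nhds (Real.exp (2 * π * (1 + 1⁻¹)))) := by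
      have : ContinuousAt (fun t : ℝ => Real.exp (2 * π * (t + t⁻¹))) 1 := by
        fun_prop (disch := norm_num)
      exact this.tendsto.mono_left nhdsWithin_le_nhds
    refine le_of_tendsto_of_tendsto l1 l2 ?_
    filter_upwards [Ioo_mem_nhdsLT (show (0:ℝ) < 1 by norm_num)] with t ht
    exact key t ht.1 ht.2
  have : 0 < c m * Real.exp (-(2 * π * 1)) ^ (m - 1) := by positivity
  have he : Real.exp (2 * π * (1 + 1⁻¹)) = Real.exp (4 * π) := by congr 1; norm_num; ring
  linarith
end bound

/-- If `c : ℕ → ℤ` are the coefficients of the `q`-expansion of the modular `j`-invariant,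
characterized by `(1/q + ∑ c(n) qⁿ) · q∏(1-qⁿ)²⁴ = (1 + 240 ∑ σ₃(n) qⁿ)³`,
then all `c(n)` are nonnegative and `c(n) < e^{4π√n}` for `n ≥ 1`. -/
theorem j_coeff_bounds (c : ℕ → ℤ)
    (hc : ∀ τ : ℂ, 0 < τ.im →
      (1 / Complex.exp (2 * π * I * τ) +
          ∑' n : ℕ, (c n : ℂ) * Complex.exp (2 * π * I * τ) ^ n) *
        (Complex.exp (2 * π * I * τ) *
          ∏' n : ℕ, (1 - Complex.exp (2 * π * I * τ) ^ (n + 1)) ^ 24) =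
      (1 + 240 * ∑' n : ℕ, (∑ d ∈ (n + 1).divisors, (d : ℂ) ^ 3) *
          Complex.exp (2 * π * I * τ) ^ (n + 1)) ^ 3) :
    (∀ n, 0 ≤ c n) ∧ ∀ n : ℕ, 1 ≤ n → (c n : ℝ) < Real.exp (4 * π * Real.sqrt n) := by
  have hc' : ∀ q : ℂ, q ≠ 0 → ‖q‖ < 1 →
      (1 / q + ∑' n : ℕ, (c n : ℂ) * q ^ n) * (q * jP q) = jE q ^ 3 := by
    intro q h0 hq
    obtain ⟨τ, hτ, rfl⟩ := surj_q h0 hq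
    exact hc τ hτ
  have h0 := c_nonneg hc'
  refine ⟨h0, fun n hn => ?_⟩
  have h0' : ∀ n, (0 : ℝ) ≤ c n := fun n => by exact_mod_cast h0 n
  have hs : ∀ r : ℝ, 0 < r → r < 1 → Summable fun n => (c n : ℝ) * r ^ n := fun r h1 h2 =>
    (c_summable hc' h1 h2).congr fun n => by rw [abs_of_nonneg (h0' n)]
  have hJ := fun (t : ℝ) (ht : 0 < t) => j_inv hc' ht
  rcases hn.eq_or_lt with rfl | h2
  · simpa using bound_one (c := fun n => (c n : ℝ)) h0' hs hJ
  · exact bound_ge_two (c := fun n => (c n : ℝ)) h0' hs hJ h2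
end

section
/- Fix R > 0. For an L-function in the extended Selberg class with zero counting functions satisfying N⁺(T), N⁻(T) = (d/(2π))T log T + cT + O(log T) and all non-trivial zeros ρ = β + iγ having |β| bounded, the imaginary part of Σ_ρ 1/(R - ρ) (principal value over |γ| < T, T → ∞) is O((log R)/R) as R → ∞. -/
open Complex Real Filter

lemma abel_aux (F : Finset ℂ) (w : ℂ → ℝ) (φ φ' : ℝ → ℝ) (hφ : ∀ t, HasDerivAt φ (φ' t) t)
    (hc : Continuous φ') (T : ℝ) (hF : ∀ ρ ∈ F, |ρ.im| ≤ T) (hT : 0 ≤ T) :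
    ∑ ρ ∈ F, w ρ * φ |ρ.im| = φ T * ∑ ρ ∈ F, w ρ -
      ∫ t in (0:ℝ)..T, φ' t * ∑ ρ ∈ F.filter (fun ρ => |ρ.im| ≤ t), w ρ := by
  have h1 : ∀ t, φ' t * ∑ ρ ∈ F.filter (fun ρ => |ρ.im| ≤ t), w ρ =
      ∑ ρ ∈ F, w ρ * (Set.Ici |ρ.im|).indicator φ' t := by
    intro t
    rw [Finset.sum_filter, Finset.mul_sum]
    refine Finset.sum_congr rfl fun ρ _ => ?_
    by_cases h : |ρ.im| ≤ t
    · simp [Set.indicator, h, mul_comm]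
    · simp [Set.indicator, h]
  have h2 : ∀ a, IntervalIntegrable ((Set.Ici a).indicator φ') MeasureTheory.volume 0 T := by
    intro a
    have := (hc.intervalIntegrable (μ := MeasureTheory.volume) 0 T)
    rw [intervalIntegrable_iff] at this ⊢
    exact this.indicator measurableSet_Ici
  have h3 : ∀ a, 0 ≤ a → a ≤ T →
      ∫ t in (0:ℝ)..T, (Set.Ici a).indicator φ' t = φ T - φ a := by
    intro a ha haT
    rw [← intervalIntegral.integral_eq_sub_of_hasDerivAt (fun t _ => hφ t)
      (hc.intervalIntegrable _ _), intervalIntegral.integral_of_le hT,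
      intervalIntegral.integral_of_le haT, MeasureTheory.setIntegral_indicator measurableSet_Ici]
    have e : Set.Ioc a T = Set.Ioc 0 T ∩ Set.Ioi a := by
      ext x; simp only [Set.mem_Ioc, Set.mem_inter_iff, Set.mem_Ioi]
      constructor
      · rintro ⟨h, h'⟩; exact ⟨⟨by linarith, h'⟩, h⟩
      · rintro ⟨⟨_, h'⟩, h⟩; exact ⟨h, h'⟩
    rw [e]
    apply MeasureTheory.setIntegral_congr_set
    exact (Filter.EventuallyEq.refl _ _).inter MeasureTheory.Ioi_ae_eq_Ici.symm
  simp_rw [h1]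
  rw [intervalIntegral.integral_finsetSum (fun ρ _ => (h2 _).const_mul _), Finset.mul_sum,
    ← Finset.sum_sub_distrib]
  refine Finset.sum_congr rfl fun ρ hρ => ?_
  rw [intervalIntegral.integral_const_mul, h3 _ (abs_nonneg _) (hF ρ hρ)]
  ring

lemma key_aux (F : Finset ℂ) (w : ℂ → ℝ) (φ φ' : ℝ → ℝ) (hφ : ∀ t, HasDerivAt φ (φ' t) t)
    (hc : Continuous φ') (T : ℝ) (hF : ∀ ρ ∈ F, |ρ.im| ≤ T) (hT : 0 ≤ T) (R C : ℝ) (hR : 2 ≤ R)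
    (hC : 0 ≤ C)
    (hb : ∀ t, 0 ≤ t → t ≤ T → |φ' t * ∑ ρ ∈ F.filter (fun ρ => |ρ.im| ≤ t), w ρ| ≤
      C * (Real.log (R + t) / (R + t) ^ 2))
    (hbd : |φ T * ∑ ρ ∈ F, w ρ| ≤ C * (Real.log (R + T) / (R + T))) :
    |∑ ρ ∈ F, w ρ * φ (|ρ.im|)| ≤ 3 * C * (Real.log R / R) := by
  rw [abel_aux F w φ φ' hφ hc T hF hT]
  have hcont : ContinuousOn (fun t => Real.log (R + t) / (R + t) ^ 2) (Set.uIcc 0 T) := by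
    intro t ht
    rw [Set.uIcc_of_le hT] at ht
    have : R + t ≠ 0 := by linarith [ht.1]
    apply ContinuousAt.continuousWithinAt
    fun_prop (disch := simpa using this)
  have hi : ∫ t in (0:ℝ)..T, Real.log (R + t) / (R + t) ^ 2 =
      -((Real.log (R + T) + 1) / (R + T)) - -((Real.log (R + 0) + 1) / (R + 0)) := by
    apply intervalIntegral.integral_eq_sub_of_hasDerivAt
      (f := fun t => -((Real.log (R + t) + 1) / (R + t))) _ hcont.intervalIntegrable
    intro t ht
    rw [Set.uIcc_of_le hT] at ht
    have h0 : R + t ≠ 0 := by linarith [ht.1]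
    have h1 : HasDerivAt (fun t => R + t) 1 t := (hasDerivAt_id t).const_add R
    refine HasDerivAt.congr_deriv (((h1.log h0).add_const 1).div h1 h0).neg ?_
    field_simp
    ring
  have hint : |∫ t in (0:ℝ)..T, φ' t * ∑ ρ ∈ F.filter (fun ρ => |ρ.im| ≤ t), w ρ| ≤
      ∫ t in (0:ℝ)..T, C * (Real.log (R + t) / (R + t) ^ 2) := by
    rw [← Real.norm_eq_abs]
    apply intervalIntegral.norm_integral_le_of_norm_le hT
    · exact Filter.Eventually.of_forall fun t ht => hb t ht.1.le ht.2
    · exact hcont.intervalIntegrable.const_mul C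
  rw [intervalIntegral.integral_const_mul, hi] at hint
  have hl : 1 ≤ 2 * Real.log R := by
    have := Real.log_le_log (by norm_num) hR
    linarith [Real.log_two_gt_d9]
  have h5 : (Real.log R + 1) / R ≤ 3 * (Real.log R / R) := by
    rw [← mul_div_assoc]; gcongr; linarith
  have h6 : 0 ≤ C * (1 / (R + T)) := by positivity
  have h7 := mul_le_mul_of_nonneg_left h5 hC
  refine (abs_sub _ _).trans ?_
  rw [add_zero] at hint
  have h8 : (Real.log (R + T) + 1) / (R + T) = Real.log (R+T) / (R+T) + 1 / (R+T) := add_div _ _ _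
  rw [h8] at hint
  nlinarith

lemma sum_h_aux (F : Finset ℂ) (T : ℝ) (hF : ∀ ρ ∈ F, |ρ.im| ≤ T) (hT : 0 ≤ T) (R C : ℝ)
    (hR : 2 ≤ R) (hC : 0 ≤ C)
    (hN : ∀ t, 0 ≤ t → t ≤ T → ((F.filter (fun ρ => |ρ.im| ≤ t)).card : ℝ) ≤
      C * ((t + 2) * Real.log (t + 2))) :
    ∑ ρ ∈ F, 1 / (R ^ 2 + ρ.im ^ 2) ≤ 24 * C * (Real.log R / R) := by
  have hQ : ∀ t : ℝ, 0 < R ^ 2 + t ^ 2 := fun t => by positivity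
  have hlog : ∀ t : ℝ, 0 ≤ t → Real.log (t + 2) ≤ Real.log (R + t) := fun t ht =>
    Real.log_le_log (by linarith) (by linarith)
  have hlog0 : ∀ t : ℝ, 0 ≤ t → 0 ≤ Real.log (t + 2) := fun t ht =>
    Real.log_nonneg (by linarith)
  have key := key_aux F (fun _ => 1) (fun t => 1 / (R ^ 2 + t ^ 2))
    (fun t => -(2 * t) / (R ^ 2 + t ^ 2) ^ 2) ?_ ?_ T hF hT R (8 * C) hR (by positivity) ?_ ?_
  · refine (le_abs_self _).trans ?_
    simp only [sq_abs, one_mul] at key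
    linarith
  · intro t
    have h1 : HasDerivAt (fun t : ℝ => R ^ 2 + t ^ 2) (2 * t) t := by
      simpa using (hasDerivAt_pow 2 t).const_add (R ^ 2)
    have h2 := h1.inv (hQ t).ne'
    simp only [one_div]
    exact h2
  · refine Continuous.div (by fun_prop) (by fun_prop) fun t => (pow_pos (hQ t) 2).ne'
  · intro t ht htT
    rw [Finset.sum_const, nsmul_one, abs_mul, abs_div, abs_neg, abs_of_nonneg (by positivity : 0 ≤ 2 * t),
      abs_of_nonneg (by positivity : 0 ≤ (R ^ 2 + t ^ 2) ^ 2), abs_of_nonneg (Nat.cast_nonneg _)]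
    calc _ ≤ 2 * t / (R ^ 2 + t ^ 2) ^ 2 * (C * ((t + 2) * Real.log (R + t))) := by
          have h1 := hN t ht htT
          have h2 := hlog t ht
          have : 0 ≤ 2 * t / (R ^ 2 + t ^ 2) ^ 2 := by positivity
          refine mul_le_mul_of_nonneg_left (h1.trans ?_) this
          gcongr
      _ = C * Real.log (R + t) * (2 * t * (t + 2) / (R ^ 2 + t ^ 2) ^ 2) := by ring
      _ ≤ C * Real.log (R + t) * (8 / (R + t) ^ 2) := by
          have := (hlog0 t ht).trans (hlog t ht)
          refine mul_le_mul_of_nonneg_left ?_ (by positivity)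
          rw [div_le_div_iff₀ (pow_pos (hQ t) 2) (by positivity)]
          have e1 : (R + t) ^ 2 ≤ 2 * (R ^ 2 + t ^ 2) := by nlinarith [sq_nonneg (R - t)]
          have e2 : 2 * t * (t + 2) ≤ 4 * (R ^ 2 + t ^ 2) := by nlinarith
          calc _ ≤ (4 * (R ^ 2 + t ^ 2)) * (2 * (R ^ 2 + t ^ 2)) := by gcongr
            _ = _ := by ring
      _ = _ := by ring
  · have h1 := hN T hT le_rfl
    rw [Finset.filter_true_of_mem hF] at h1
    rw [Finset.sum_const, nsmul_one, abs_mul, abs_of_nonneg (by positivity : 0 ≤ 1 / (R ^ 2 + T ^ 2)),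
      abs_of_nonneg (Nat.cast_nonneg _)]
    have h2 := hlog T hT
    have h3 := (hlog0 T hT).trans h2
    calc _ ≤ 1 / (R ^ 2 + T ^ 2) * (C * ((T + R) * Real.log (R + T))) := by
          refine mul_le_mul_of_nonneg_left (h1.trans ?_) (by positivity)
          have := hlog0 T hT
          gcongr
      _ = C * Real.log (R + T) * ((T + R) / (R ^ 2 + T ^ 2)) := by ring
      _ ≤ C * Real.log (R + T) * (8 / (R + T)) := by
          refine mul_le_mul_of_nonneg_left ?_ (by positivity)
          rw [div_le_div_iff₀ (hQ T) (by positivity)]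
          nlinarith [sq_nonneg (R - T)]
      _ = _ := by ring

lemma sum_g_aux (F : Finset ℂ) (w : ℂ → ℝ) (T : ℝ) (hF : ∀ ρ ∈ F, |ρ.im| ≤ T) (hT : 0 ≤ T)
    (R C : ℝ) (hR : 2 ≤ R) (hC : 0 ≤ C)
    (hN : ∀ t, 0 ≤ t → t ≤ T → |∑ ρ ∈ F.filter (fun ρ => |ρ.im| ≤ t), w ρ| ≤
      C * Real.log (t + 2)) :
    |∑ ρ ∈ F, w ρ * (|ρ.im| / (R ^ 2 + ρ.im ^ 2))| ≤ 6 * C * (Real.log R / R) := by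
  have hQ : ∀ t : ℝ, 0 < R ^ 2 + t ^ 2 := fun t => by positivity
  have hlog : ∀ t : ℝ, 0 ≤ t → Real.log (t + 2) ≤ Real.log (R + t) := fun t ht =>
    Real.log_le_log (by linarith) (by linarith)
  have hlog0 : ∀ t : ℝ, 0 ≤ t → 0 ≤ Real.log (t + 2) := fun t ht =>
    Real.log_nonneg (by linarith)
  have key := key_aux F w (fun t => t / (R ^ 2 + t ^ 2))
    (fun t => (R ^ 2 - t ^ 2) / (R ^ 2 + t ^ 2) ^ 2) ?_ ?_ T hF hT R (2 * C) hR (by positivity) ?_ ?_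
  · simp only [sq_abs] at key
    linarith
  · intro t
    have h1 : HasDerivAt (fun t : ℝ => R ^ 2 + t ^ 2) (2 * t) t := by
      simpa using (hasDerivAt_pow 2 t).const_add (R ^ 2)
    refine HasDerivAt.congr_deriv ((hasDerivAt_id t).div h1 (hQ t).ne') ?_
    simp only [id_eq]
    ring
  · refine Continuous.div (by fun_prop) (by fun_prop) fun t => (pow_pos (hQ t) 2).ne'
  · intro t ht htT
    rw [abs_mul, abs_div, abs_of_nonneg (by positivity : 0 ≤ (R ^ 2 + t ^ 2) ^ 2)]
    have e1 : (R + t) ^ 2 ≤ 2 * (R ^ 2 + t ^ 2) := by nlinarith [sq_nonneg (R - t)]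
    have e2 : |R ^ 2 - t ^ 2| ≤ R ^ 2 + t ^ 2 := by
      rw [abs_le]; constructor <;> nlinarith
    have e3 : |R ^ 2 - t ^ 2| / (R ^ 2 + t ^ 2) ^ 2 ≤ 2 / (R + t) ^ 2 := by
      rw [div_le_div_iff₀ (pow_pos (hQ t) 2) (by positivity)]
      calc _ ≤ (R ^ 2 + t ^ 2) * (2 * (R ^ 2 + t ^ 2)) := by gcongr
        _ = _ := by ring
    calc _ ≤ 2 / (R + t) ^ 2 * (C * Real.log (R + t)) := by
          have h1 := hN t ht htT
          have h2 := hlog t ht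
          refine mul_le_mul e3 (h1.trans ?_) (abs_nonneg _) (by positivity)
          gcongr
      _ = _ := by ring
  · have h1 := hN T hT le_rfl
    rw [Finset.filter_true_of_mem hF] at h1
    rw [abs_mul, abs_of_nonneg (by positivity : 0 ≤ T / (R ^ 2 + T ^ 2))]
    have h2 := hlog T hT
    have e3 : T / (R ^ 2 + T ^ 2) ≤ 2 / (R + T) := by
      rw [div_le_div_iff₀ (hQ T) (by positivity)]
      nlinarith [sq_nonneg (R - T)]
    calc _ ≤ 2 / (R + T) * (C * Real.log (R + T)) := by
          refine mul_le_mul e3 (h1.trans ?_) (abs_nonneg _) (by positivity)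
          gcongr
      _ = _ := by ring

lemma im_inv_aux (R : ℝ) (ρ : ℂ) :
    (1 / ((R : ℂ) - ρ)).im = ρ.im / ((R - ρ.re) ^ 2 + ρ.im ^ 2) := by
  rw [one_div, Complex.inv_im, Complex.normSq_apply]
  simp
  ring

lemma diff_aux (σ δ : ℝ) (hσ : 1 ≤ σ) (hδ : 0 < δ) (R : ℝ) (hR : 2 ≤ R) (b y : ℝ) (hb : |b| ≤ σ)
    (hy : y = 0 ∨ δ ≤ |y|) :
    |y / ((R - b) ^ 2 + y ^ 2) - y / (R ^ 2 + y ^ 2)| ≤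
      3 * σ ^ 2 * (3 + 2 * σ ^ 2 / δ ^ 2) * (1 / (R ^ 2 + y ^ 2)) := by
  rcases hy with rfl | hy
  · simp; positivity
  have hyp : 0 < |y| := hδ.trans_le hy
  have hy2 : 0 < y ^ 2 := by rw [← sq_abs]; positivity
  have hδy : δ ^ 2 ≤ y ^ 2 := by rw [← sq_abs y]; gcongr
  have hP : 0 < (R - b) ^ 2 + y ^ 2 := by positivity
  have hQ : 0 < R ^ 2 + y ^ 2 := by positivity
  have hb2 : b ^ 2 ≤ σ ^ 2 := by rw [← sq_abs]; gcongr
  have hA : R ^ 2 + y ^ 2 ≤ (3 + 2 * σ ^ 2 / δ ^ 2) * ((R - b) ^ 2 + y ^ 2) := by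
    have h1 : σ ^ 2 ≤ σ ^ 2 / δ ^ 2 * y ^ 2 := by
      rw [div_mul_eq_mul_div, le_div_iff₀ (by positivity)]; gcongr
    have h2 : 0 ≤ σ ^ 2 / δ ^ 2 * (R - b) ^ 2 := by positivity
    have h3 : R ^ 2 ≤ 2 * (R - b) ^ 2 + 2 * b ^ 2 := by nlinarith [sq_nonneg (R - 2 * b)]
    rw [mul_div_assoc]
    nlinarith [sq_nonneg (R - b)]
  have e : y / ((R - b) ^ 2 + y ^ 2) - y / (R ^ 2 + y ^ 2) =
      y * (2 * R * b - b ^ 2) / (((R - b) ^ 2 + y ^ 2) * (R ^ 2 + y ^ 2)) := by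
    field_simp; ring
  rw [e, abs_div, abs_of_pos (mul_pos hP hQ), abs_mul, mul_one_div, div_le_div_iff₀ (by positivity) hQ]
  have h1 : |2 * R * b - b ^ 2| ≤ 3 * σ ^ 2 * R := by
    have : |2 * R * b - b ^ 2| ≤ |2 * R * b| + |b ^ 2| := abs_sub _ _
    rw [abs_mul, abs_of_nonneg (by positivity : 0 ≤ 2 * R), abs_of_nonneg (sq_nonneg b)] at this
    have h4 : 2 * R * |b| ≤ 2 * R * σ ^ 2 := by
      gcongr; nlinarith
    nlinarith [sq_nonneg σ]
  have h2 : |y| * R ≤ R ^ 2 + y ^ 2 := by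
    rw [← sq_abs y]; nlinarith [sq_nonneg (|y| - R), sq_nonneg (|y|), sq_nonneg R]
  have h3 : |y| * |2 * R * b - b ^ 2| ≤ 3 * σ ^ 2 * (R ^ 2 + y ^ 2) := by
    calc _ ≤ |y| * (3 * σ ^ 2 * R) := by gcongr
      _ = 3 * σ ^ 2 * (|y| * R) := by ring
      _ ≤ _ := by gcongr
  calc _ ≤ 3 * σ ^ 2 * (R ^ 2 + y ^ 2) * ((3 + 2 * σ ^ 2 / δ ^ 2) * ((R - b) ^ 2 + y ^ 2)) :=
        mul_le_mul h3 hA hQ.le (by positivity)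
    _ = _ := by ring

/-- For an `L`-function in the extended Selberg class, with non-trivial zeros
`ρ = β + iγ` satisfying `1 - σ₀ ≤ β ≤ σ₀` and zero-counting functions
`N⁺(T), N⁻(T) = (d/2π) T log T + cT + O(log T)`, the imaginary part of the
principal-value sum `∑_ρ 1/(R-ρ)` is `O((log R)/R)` as `R → ∞`. -/
theorem im_sum_inv_sub_zeros_bound (Z : Set ℂ) (σ₀ : ℝ) (hσ₀ : 1 ≤ σ₀)
    (hβ : ∀ ρ ∈ Z, 1 - σ₀ ≤ ρ.re ∧ ρ.re ≤ σ₀)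
    (hfin : ∀ T : ℝ, (Z ∩ {ρ : ℂ | |ρ.im| ≤ T}).Finite)
    (d c : ℝ)
    (hN : ∃ C > 0, ∀ T : ℝ, 2 ≤ T →
      |(((hfin T).toFinset.filter (fun ρ => 0 ≤ ρ.im)).card : ℝ) -
          (d / (2 * π) * T * Real.log T + c * T)| ≤ C * Real.log T ∧
      |(((hfin T).toFinset.filter (fun ρ => ρ.im ≤ 0)).card : ℝ) -
          (d / (2 * π) * T * Real.log T + c * T)| ≤ C * Real.log T)
    (S : ℝ → ℂ)
    (hS : ∀ R : ℝ, Tendsto (fun T : ℝ => ∑ ρ ∈ (hfin T).toFinset, 1 / ((R : ℂ) - ρ))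
      atTop (nhds (S R))) :
    ∃ C > 0, ∀ R : ℝ, 2 ≤ R → |(S R).im| ≤ C * Real.log R / R := by
  obtain ⟨C, hC, hN⟩ := hN
  set K : ℝ := ((hfin 2).toFinset.card : ℝ) with hK
  have hK0 : 0 ≤ K := Nat.cast_nonneg _
  have hmono : ∀ s t : ℝ, s ≤ t → (hfin s).toFinset ⊆ (hfin t).toFinset := by
    intro s t hst ρ hρ
    simp only [Set.Finite.mem_toFinset, Set.mem_inter_iff, Set.mem_ofPred_eq] at hρ ⊢
    exact ⟨hρ.1, hρ.2.trans hst⟩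
  have hfilt : ∀ t T : ℝ, t ≤ T →
      (hfin T).toFinset.filter (fun ρ => |ρ.im| ≤ t) = (hfin t).toFinset := by
    intro t T h
    ext ρ
    simp only [Finset.mem_filter, Set.Finite.mem_toFinset, Set.mem_inter_iff, Set.mem_ofPred_eq]
    constructor
    · rintro ⟨⟨h1, _⟩, h2⟩; exact ⟨h1, h2⟩
    · rintro ⟨h1, h2⟩; exact ⟨⟨h1, h2.trans h⟩, h2⟩
  let w : ℂ → ℝ := fun ρ => (if 0 ≤ ρ.im then 1 else 0) - (if ρ.im ≤ 0 then 1 else 0)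
  have hwabs : ∀ ρ, |w ρ| ≤ 1 := by
    intro ρ
    simp only [w]
    split_ifs <;> norm_num
  have hwim : ∀ ρ : ℂ, w ρ * |ρ.im| = ρ.im := by
    intro ρ
    simp only [w]
    rcases lt_trichotomy ρ.im 0 with h | h | h
    · simp [h.le, h.not_ge, abs_of_neg h]
    · simp [h]
    · simp [h.le, h.not_ge, abs_of_pos h]
  have hwsum : ∀ F : Finset ℂ, ∑ ρ ∈ F, w ρ = ((F.filter (fun ρ => 0 ≤ ρ.im)).card : ℝ) -
      ((F.filter (fun ρ => ρ.im ≤ 0)).card : ℝ) := by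
    intro F
    simp only [w, Finset.sum_sub_distrib, Finset.card_filter]
    push_cast
    rfl
  have hl2 : (1:ℝ) / 2 ≤ Real.log 2 := by linarith [Real.log_two_gt_d9]
  have hlt : ∀ t : ℝ, 0 ≤ t → 1 / 2 ≤ Real.log (t + 2) := fun t ht =>
    hl2.trans (Real.log_le_log (by norm_num) (by linarith))
  -- signed count
  have hD : ∀ t : ℝ, 0 ≤ t → |∑ ρ ∈ (hfin t).toFinset, w ρ| ≤
      (2 * C + 2 * K) * Real.log (t + 2) := by
    intro t ht
    have hl := hlt t ht
    rcases le_total 2 t with h | h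
    · obtain ⟨h1, h2⟩ := hN t h
      rw [hwsum]
      have h3 : Real.log t ≤ Real.log (t + 2) := Real.log_le_log (by linarith) (by linarith)
      have h4 : C * Real.log t ≤ C * Real.log (t + 2) := by gcongr
      have h5 : 0 ≤ K * Real.log (t + 2) := by positivity
      rw [abs_le] at h1 h2 ⊢
      constructor <;> linarith [h1.1, h1.2, h2.1, h2.2]
    · have h1 : |∑ ρ ∈ (hfin t).toFinset, w ρ| ≤ K := by
        refine (Finset.abs_sum_le_sum_abs _ _).trans ?_
        refine (Finset.sum_le_sum fun ρ _ => hwabs ρ).trans ?_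
        rw [Finset.sum_const, nsmul_one]
        exact Nat.cast_le.2 (Finset.card_le_card (hmono t 2 h))
      have h5 : 0 ≤ C * Real.log (t + 2) := by positivity
      nlinarith
  -- total count
  set E : ℝ := 2 * |d / (2 * π)| + 4 * |c| + 2 * C + K with hE
  have hE0 : 0 ≤ E := by positivity
  have hcount : ∀ t : ℝ, 0 ≤ t → ((hfin t).toFinset.card : ℝ) ≤
      E * ((t + 2) * Real.log (t + 2)) := by
    intro t ht
    have hl := hlt t ht
    have hx : 1 ≤ (t + 2) * Real.log (t + 2) := by nlinarith
    rcases le_total 2 t with h | h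
    · obtain ⟨h1, h2⟩ := hN t h
      have hcard : ((hfin t).toFinset.card : ℝ) ≤
          (((hfin t).toFinset.filter (fun ρ => 0 ≤ ρ.im)).card : ℝ) +
          (((hfin t).toFinset.filter (fun ρ => ρ.im ≤ 0)).card : ℝ) := by
        have : (hfin t).toFinset ⊆ (hfin t).toFinset.filter (fun ρ => 0 ≤ ρ.im) ∪
            (hfin t).toFinset.filter (fun ρ => ρ.im ≤ 0) := by
          intro ρ hρ
          rw [Finset.mem_union, Finset.mem_filter, Finset.mem_filter]
          rcases le_total 0 ρ.im with h | h
          · exact Or.inl ⟨hρ, h⟩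
          · exact Or.inr ⟨hρ, h⟩
        exact_mod_cast (Finset.card_le_card this).trans (Finset.card_union_le _ _)
      have h3 : Real.log t ≤ Real.log (t + 2) := Real.log_le_log (by linarith) (by linarith)
      have h30 : 0 ≤ Real.log t := Real.log_nonneg (by linarith)
      have a1 : d / (2 * π) * t * Real.log t ≤
          |d / (2 * π)| * ((t + 2) * Real.log (t + 2)) := by
        rw [mul_assoc]
        refine mul_le_mul (le_abs_self _) ?_ (by positivity) (abs_nonneg _)
        gcongr; linarith
      have a2 : c * t ≤ |c| * (2 * ((t + 2) * Real.log (t + 2))) := by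
        refine mul_le_mul (le_abs_self _) ?_ (by positivity) (abs_nonneg _)
        nlinarith
      have a3 : C * Real.log t ≤ C * ((t + 2) * Real.log (t + 2)) := by
        gcongr; nlinarith
      have a4 : 0 ≤ K * ((t + 2) * Real.log (t + 2)) := by positivity
      rw [hE]
      linarith [(abs_le.1 h1).2, (abs_le.1 h2).2]
    · have h1 : ((hfin t).toFinset.card : ℝ) ≤ K := by
        exact Nat.cast_le.2 (Finset.card_le_card (hmono t 2 h))
      have h2 : K ≤ E := by
        have : 0 ≤ 2 * |d / (2 * π)| + 4 * |c| + 2 * C := by positivity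
        rw [hE]; linarith
      calc _ ≤ K := h1
        _ ≤ E * 1 := by linarith
        _ ≤ _ := by gcongr
  -- gap
  obtain ⟨δ, hδ, hgap⟩ : ∃ δ : ℝ, 0 < δ ∧ ∀ ρ ∈ Z, ρ.im = 0 ∨ δ ≤ |ρ.im| := by
    have hfp : ∀ F : Finset ℂ, ∃ δ : ℝ, 0 < δ ∧ ∀ ρ ∈ F, ρ.im = 0 ∨ δ ≤ |ρ.im| := by
      intro F
      induction F using Finset.induction_on with
      | empty => exact ⟨1, one_pos, by simp⟩
      | insert a s ha ih =>
        obtain ⟨δ, hδ, h⟩ := ih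
        by_cases h0 : a.im = 0
        · refine ⟨δ, hδ, fun ρ hρ => ?_⟩
          rcases Finset.mem_insert.1 hρ with rfl | hρ
          · exact Or.inl h0
          · exact h ρ hρ
        · refine ⟨min δ |a.im|, lt_min hδ (abs_pos.2 h0), fun ρ hρ => ?_⟩
          rcases Finset.mem_insert.1 hρ with rfl | hρ
          · exact Or.inr (min_le_right _ _)
          · exact (h ρ hρ).imp_right (min_le_left _ _).trans
    obtain ⟨δ, hδ, h⟩ := hfp (hfin 1).toFinset
    refine ⟨min δ 1, lt_min hδ one_pos, fun ρ hρ => ?_⟩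
    rcases le_total |ρ.im| 1 with h1 | h1
    · exact (h ρ (by simp [hρ, h1])).imp_right (min_le_left _ _).trans
    · exact Or.inr ((min_le_right _ _).trans h1)
  set M : ℝ := 3 * σ₀ ^ 2 * (3 + 2 * σ₀ ^ 2 / δ ^ 2) with hM
  have hM0 : 0 ≤ M := by positivity
  refine ⟨M * (24 * E) + 6 * (2 * C + 2 * K), by positivity, fun R hR => ?_⟩
  have hlim := (Complex.continuous_im.tendsto (S R)).comp (hS R)
  refine le_of_tendsto hlim.abs ?_
  filter_upwards [eventually_ge_atTop (0:ℝ)] with T hT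
  have hF : ∀ ρ ∈ (hfin T).toFinset, |ρ.im| ≤ T := by
    intro ρ hρ
    simp only [Set.Finite.mem_toFinset, Set.mem_inter_iff, Set.mem_ofPred_eq] at hρ
    exact hρ.2
  have b1 := sum_h_aux (hfin T).toFinset T hF hT R E hR hE0 (by
    intro t ht htT
    rw [hfilt t T htT]
    exact hcount t ht)
  have b2 := sum_g_aux (hfin T).toFinset w T hF hT R (2 * C + 2 * K) hR (by positivity) (by
    intro t ht htT
    rw [hfilt t T htT]
    exact hD t ht)
  have b3 : |∑ ρ ∈ (hfin T).toFinset,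
      (ρ.im / ((R - ρ.re) ^ 2 + ρ.im ^ 2) - ρ.im / (R ^ 2 + ρ.im ^ 2))| ≤
      M * ∑ ρ ∈ (hfin T).toFinset, 1 / (R ^ 2 + ρ.im ^ 2) := by
    refine (Finset.abs_sum_le_sum_abs _ _).trans ?_
    rw [Finset.mul_sum]
    refine Finset.sum_le_sum fun ρ hρ => ?_
    have hρ' : ρ ∈ Z := by
      simp only [Set.Finite.mem_toFinset, Set.mem_inter_iff, Set.mem_ofPred_eq] at hρ
      exact hρ.1
    obtain ⟨h1, h2⟩ := hβ ρ hρ'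
    exact diff_aux σ₀ δ hσ₀ hδ R hR ρ.re ρ.im (abs_le.2 ⟨by linarith, h2⟩) (hgap ρ hρ')
  have e : (∑ ρ ∈ (hfin T).toFinset, 1 / ((R : ℂ) - ρ)).im =
      (∑ ρ ∈ (hfin T).toFinset,
        (ρ.im / ((R - ρ.re) ^ 2 + ρ.im ^ 2) - ρ.im / (R ^ 2 + ρ.im ^ 2))) +
      ∑ ρ ∈ (hfin T).toFinset, w ρ * (|ρ.im| / (R ^ 2 + ρ.im ^ 2)) := by
    rw [Complex.im_sum, ← Finset.sum_add_distrib]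
    refine Finset.sum_congr rfl fun ρ _ => ?_
    rw [im_inv_aux, ← mul_div_assoc, hwim]
    ring
  show |(∑ ρ ∈ (hfin T).toFinset, 1 / ((R : ℂ) - ρ)).im| ≤ _
  rw [e]
  refine (abs_add_le _ _).trans ?_
  have b4 := b3.trans (mul_le_mul_of_nonneg_left b1 hM0)
  rw [mul_div_assoc]
  linarith
end
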